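/- arXiv:1504.07183 — 9 statements merged into one kernel-verified Lean document; each statement's English description precedes it below -/
import Mathlib

section
/- Every M-inversive semigroup is left equalizer simple. -/
/-- A semigroup `S` is left equalizer simple if whenever `x₀ * a = x₀ * b` for some `x₀`,
then `x * a = x * b` for all `x`. -/
def LeftEqualizerSimple (S : Type*) [Semigroup S] : Prop :=
  ∀ a b : S, (∃ x₀ : S, x₀ * a = x₀ * b) → ∀ x : S, x * a = x * b

/-- `u` is a middle unit of `S` if `c * u * d = c * d` for all `c, d ∈ S`. -/
def IsMiddleUnit {S : Type*} [Semigroup S] (u : S) : Prop :=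
  ∀ c d : S, c * u * d = c * d

/-- Every `M`-inversive semigroup is left equalizer simple. -/
theorem mInversive_leftEqualizerSimple {S : Type*} [Semigroup S]
    (h : ∀ a : S, ∃ x y : S, IsMiddleUnit (a * x) ∧ IsMiddleUnit (y * a)) :
    LeftEqualizerSimple S := by
  rintro a b ⟨x₀, hx₀⟩ x
  obtain ⟨_, y, _, hy⟩ := h x₀
  rw [← hy x a, ← hy x b]
  simp only [mul_assoc, hx₀]
end

section
/- A semigroup S is left equalizer simple if and only if its right regular representation is a left cancellative semigroup; that is, S is left equalizer simple if and only if the quotient semigroup S/θ_S is left cancellative, where θ_S = {(a,b) ∈ S × S : xa = xb for all x ∈ S}. -/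
/-- The congruence `θ_S = {(a,b) : x * a = x * b for all x}` on a semigroup `S`. -/
def theta (S : Type*) [Semigroup S] : Con S where
  r a b := ∀ x : S, x * a = x * b
  iseqv := ⟨fun _ _ => rfl, fun h x => (h x).symm, fun h1 h2 x => (h1 x).trans (h2 x)⟩
  mul' := by
    intro a b c d h1 h2 x
    calc x * (a * c) = (x * a) * c := (mul_assoc ..).symm
    _ = (x * b) * c := by rw [h1 x]
    _ = (x * b) * d := h2 (x * b)
    _ = x * (b * d) := mul_assoc ..

/-- For a congruence `ρ` on a semigroup `S`, `ρ*` is the congruence with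
`(a,b) ∈ ρ*` iff `(x*a, x*b) ∈ ρ` for all `x ∈ S`. -/
def conStar {S : Type*} [Semigroup S] (ρ : Con S) : Con S where
  r a b := ∀ x : S, ρ (x * a) (x * b)
  iseqv := ⟨fun _ _ => ρ.refl _, fun h x => ρ.symm (h x), fun h1 h2 x => ρ.trans (h1 x) (h2 x)⟩
  mul' := by
    intro a b c d h1 h2 x
    have e1 : ρ (x * a * c) (x * b * c) := ρ.mul (h1 x) (ρ.refl c)
    have e2 : ρ (x * b * c) (x * b * d) := h2 (x * b)
    simpa [mul_assoc] using ρ.trans e1 e2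

/-- A congruence `ρ` is a left equalizer simple congruence if `(x₀*a, x₀*b) ∈ ρ` for some `x₀`
implies `(x*a, x*b) ∈ ρ` for all `x`. -/
def LeftEqualizerSimpleCon {S : Type*} [Semigroup S] (ρ : Con S) : Prop :=
  ∀ a b : S, (∃ x₀ : S, ρ (x₀ * a) (x₀ * b)) → ∀ x : S, ρ (x * a) (x * b)

/-- A semigroup `S` is left equalizer simple iff its right regular representation
`S/θ_S` is a left cancellative semigroup. -/
theorem leftEqualizerSimple_iff_rightRegular_leftCancellative
    {S : Type*} [Semigroup S] :
    LeftEqualizerSimple S ↔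
      (∀ u v w : (theta S).Quotient, u * v = u * w → v = w) := by
  constructor
  · intro h u v w
    induction u using Con.induction_on with | H s
    induction v using Con.induction_on with | H a
    induction w using Con.induction_on with | H b
    intro huv
    have hθ : ∀ x : S, x * (s * a) = x * (s * b) := (theta S).eq.mp huv
    exact (theta S).eq.mpr (h a b ⟨s * s, by simpa only [mul_assoc] using hθ s⟩)
  · rintro h a b ⟨x₀, hx₀⟩
    have hmul : (x₀ : (theta S).Quotient) * a = x₀ * b := by
      rw [← Con.coe_mul, ← Con.coe_mul, hx₀]
    exact (theta S).eq.mp (h _ _ _ hmul)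
end

section
/- Let T be a left cancellative semigroup, let (S_t)_{t∈T} be a family of non-empty pairwise disjoint sets, and for every pair (t,r) ∈ T × T with r ∈ tT let f_{(t,r)} : S_t → S_r be a map such that for all t ∈ T, r ∈ tT, q ∈ rT (so also q ∈ tT) and a ∈ S_t one has f_{(r,q)}(f_{(t,r)}(a)) = f_{(t,q)}(a). On S = ⋃_{t∈T} S_t define a ⋆ b = f_{(t,tx)}(a) for a ∈ S_t and b ∈ S_x. Then ⋆ is associative, and the semigroup (S; ⋆) is left equalizer simple. -/
/-- The operation `⋆` of Construction 1: for `a ∈ S_t` and `b ∈ S_x`,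
`a ⋆ b = f_{(t, t*x)}(a)`. -/
def starOp {T : Type*} [Semigroup T] {S : T → Type*}
    (f : ∀ t r : T, (∃ u : T, t * u = r) → S t → S r) :
    (Σ t, S t) → (Σ t, S t) → Σ t, S t :=
  fun a b => ⟨a.1 * b.1, f a.1 (a.1 * b.1) ⟨b.1, rfl⟩ a.2⟩

/-- The image `f_{(t,r)}(a)`, as an element of the union, depends only on `r` and `a`. -/
theorem sigma_mk_map_congr {T : Type*} [Semigroup T] {S : T → Type*}
    (f : ∀ t r : T, (∃ u : T, t * u = r) → S t → S r) {t r r' : T} (e : r = r')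
    (h : ∃ u : T, t * u = r) (h' : ∃ u : T, t * u = r') (a : S t) :
    (⟨r, f t r h a⟩ : Σ t, S t) = ⟨r', f t r' h' a⟩ := by
  subst e
  rfl

/-- Construction 1: given a left cancellative semigroup `T`, non-empty pairwise disjoint
sets `S_t` (`t ∈ T`) and compatible maps `f_{(t,r)} : S_t → S_r` for `r ∈ tT`, the
operation `⋆` on `S = ⋃_{t∈T} S_t` is associative and the semigroup `(S, ⋆)` is
left equalizer simple. -/
theorem starOp_assoc_and_leftEqualizerSimple {T : Type*} [Semigroup T]
    (hT : ∀ x a b : T, x * a = x * b → a = b)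
    {S : T → Type*} (hS : ∀ t : T, Nonempty (S t))
    (f : ∀ t r : T, (∃ u : T, t * u = r) → S t → S r)
    (hf : ∀ (t r q : T) (h₁ : ∃ u : T, t * u = r) (h₂ : ∃ u : T, r * u = q)
      (h₃ : ∃ u : T, t * u = q) (a : S t), f r q h₂ (f t r h₁ a) = f t q h₃ a) :
    (∀ a b c : Σ t, S t, starOp f (starOp f a b) c = starOp f a (starOp f b c)) ∧
    (∀ a b : Σ t, S t, (∃ x₀ : Σ t, S t, starOp f x₀ a = starOp f x₀ b) →
      ∀ x : Σ t, S t, starOp f x a = starOp f x b) := by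
  refine ⟨fun a b c => ?_, fun a b ⟨x₀, h⟩ x => ?_⟩
  · have h₃ : ∃ u : T, a.1 * u = a.1 * b.1 * c.1 := ⟨b.1 * c.1, (mul_assoc _ _ _).symm⟩
    exact (congrArg (Sigma.mk (a.1 * b.1 * c.1)) (hf _ _ _ ⟨b.1, rfl⟩ ⟨c.1, rfl⟩ h₃ a.2)).trans
      (sigma_mk_map_congr f (mul_assoc _ _ _) _ _ _)
  · have hab : a.1 = b.1 := hT x₀.1 _ _ (congrArg Sigma.fst h)
    exact sigma_mk_map_congr f (congrArg (x.1 * ·) hab) _ _ _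
end

section
/- In the semigroup (S; ⋆) of Construction 1 (built from a left cancellative semigroup T, disjoint non-empty sets S_t, and compatible maps f_{(t,r)}), each set S_x (x ∈ T) is exactly one θ_S-class of (S; ⋆), where θ_S = {(a,b) : x ⋆ a = x ⋆ b for all x ∈ S}. -/
/-- In the semigroup `(S, ⋆)` of Construction 1, each set `S_x` (`x ∈ T`) is exactly one
`θ_S`-class, where `θ_S = {(a,b) : c ⋆ a = c ⋆ b for all c}`: two elements of `S` are
`θ_S`-related iff they lie in the same set `S_x`. -/
theorem starOp_theta_classes {T : Type*} [Semigroup T]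
    (hT : ∀ x a b : T, x * a = x * b → a = b)
    {S : T → Type*} (hS : ∀ t : T, Nonempty (S t))
    (f : ∀ t r : T, (∃ u : T, t * u = r) → S t → S r)
    (hf : ∀ (t r q : T) (h₁ : ∃ u : T, t * u = r) (h₂ : ∃ u : T, r * u = q)
      (h₃ : ∃ u : T, t * u = q) (a : S t), f r q h₂ (f t r h₁ a) = f t q h₃ a) :
    ∀ p q : Σ t, S t, (∀ c : Σ t, S t, starOp f c p = starOp f c q) ↔ p.1 = q.1 := by
  rintro ⟨s, a⟩ ⟨t, b⟩
  constructor
  · intro h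
    obtain ⟨c⟩ := hS s
    exact hT s s t (congrArg Sigma.fst (h ⟨s, c⟩))
  · rintro (rfl : s = t) c
    rfl
end

section
/- Every left equalizer simple semigroup S is isomorphic to a semigroup obtained from Construction 1: there exist a left cancellative semigroup T, a family of non-empty pairwise disjoint sets (S_t)_{t∈T}, and maps f_{(t,r)} : S_t → S_r for each pair (t,r) with r ∈ tT satisfying f_{(r,q)} ∘ f_{(t,r)} = f_{(t,q)} for all t ∈ T, r ∈ tT, q ∈ rT, such that S is isomorphic (as a semigroup) to (⋃_{t∈T} S_t; ⋆) with a ⋆ b = f_{(t,tx)}(a) for a ∈ S_t, b ∈ S_x. -/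
/-- Two elements are related when every left translate of one equals that of the other. -/
def leftEqualizerCon (S : Type*) [Semigroup S] : Con S where
  r a b := ∀ x : S, x * a = x * b
  iseqv := ⟨fun _ _ => rfl, fun h x => (h x).symm, fun h₁ h₂ x => (h₁ x).trans (h₂ x)⟩
  mul' {a b c d} hab hcd x := by
    rw [← mul_assoc, hab, hcd, mul_assoc]

theorem mul_eq_mul_of_leftEqualizerCon {S : Type*} [Semigroup S] {a b : S}
    (hab : (a : (leftEqualizerCon S).Quotient) = b) (x : S) : x * a = x * b :=
  (leftEqualizerCon S).eq.1 hab x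

theorem LeftEqualizerSimple.mul_left_cancel_quotient {S : Type*} [Semigroup S]
    (h : LeftEqualizerSimple S) (x a b : (leftEqualizerCon S).Quotient)
    (hab : x * a = x * b) : a = b := by
  induction x using Con.induction_on with | _ x
  induction a using Con.induction_on with | _ a
  induction b using Con.induction_on with | _ b
  refine (leftEqualizerCon S).eq.2 (h a b ⟨x * x, ?_⟩)
  simpa only [mul_assoc] using mul_eq_mul_of_leftEqualizerCon hab x

/-- Right multiplication by a representative of a class `u` with `t * u = r`, as a map from the
class `t` to the class `r`. -/
noncomputable def leftEqualizerTransition {S : Type*} [Semigroup S]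
    (t r : (leftEqualizerCon S).Quotient) (hr : ∃ u, t * u = r)
    (a : {a : S // (a : (leftEqualizerCon S).Quotient) = t}) :
    {a : S // (a : (leftEqualizerCon S).Quotient) = r} :=
  ⟨a.1 * Quotient.out hr.choose, by
    rw [Con.coe_mul, a.2]
    exact (congrArg (t * ·) (Quotient.out_eq hr.choose)).trans hr.choose_spec⟩

theorem LeftEqualizerSimple.transition_eq_mul {S : Type*} [Semigroup S]
    (h : LeftEqualizerSimple S) {t r : (leftEqualizerCon S).Quotient} (hr : ∃ u, t * u = r)
    (a : {a : S // (a : (leftEqualizerCon S).Quotient) = t}) (b : S) (hb : t * b = r) :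
    (leftEqualizerTransition t r hr a : S) = a * b :=
  mul_eq_mul_of_leftEqualizerCon ((Quotient.out_eq hr.choose).trans
    (h.mul_left_cancel_quotient t _ _ (hr.choose_spec.trans hb.symm))) a

/-- Every left equalizer simple semigroup is isomorphic to a semigroup obtained from
Construction 1: there are a left cancellative semigroup `T` (given by an associative,
left cancellative multiplication `mulT`), non-empty pairwise disjoint sets `St t`
(`t : T`, realized as a sigma type), and compatible maps `f t r : St t → St r` for
`r ∈ tT`, together with a bijection `e : S ≃ Σ t, St t` transporting the multiplication
of `S` to the operation `a ⋆ b = f t (t * x) a` (for `a ∈ St t`, `b ∈ St x`). -/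
theorem leftEqualizerSimple_iso_construction {S : Type u} [Semigroup S]
    (h : LeftEqualizerSimple S) :
    ∃ (T : Type u) (mulT : T → T → T),
      (∀ a b c : T, mulT (mulT a b) c = mulT a (mulT b c)) ∧
      (∀ x a b : T, mulT x a = mulT x b → a = b) ∧
      ∃ (St : T → Type u) (_ : ∀ t : T, Nonempty (St t))
        (f : ∀ t r : T, (∃ u : T, mulT t u = r) → St t → St r),
        (∀ (t r q : T) (h₁ : ∃ u : T, mulT t u = r) (h₂ : ∃ u : T, mulT r u = q)
          (h₃ : ∃ u : T, mulT t u = q) (a : St t), f r q h₂ (f t r h₁ a) = f t q h₃ a) ∧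
        ∃ e : S ≃ Σ t, St t,
          ∀ a b : S, e (a * b) =
            ⟨mulT (e a).1 (e b).1,
              f (e a).1 (mulT (e a).1 (e b).1) ⟨(e b).1, rfl⟩ (e a).2⟩ := by
  refine ⟨(leftEqualizerCon S).Quotient, (· * ·), mul_assoc, h.mul_left_cancel_quotient,
    fun t => {a : S // (a : (leftEqualizerCon S).Quotient) = t},
    fun t => ?_, leftEqualizerTransition, ?_,
    (Equiv.sigmaFiberEquiv ((↑) : S → (leftEqualizerCon S).Quotient)).symm, fun a b => ?_⟩
  · exact Con.induction_on t fun a => ⟨⟨a, rfl⟩⟩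
  · rintro t r q ⟨u, hu⟩ ⟨v, hv⟩ h₃ a
    induction u using Con.induction_on with | _ u
    induction v using Con.induction_on with | _ v
    apply Subtype.ext
    rw [h.transition_eq_mul _ _ v hv, h.transition_eq_mul _ _ u hu,
      h.transition_eq_mul h₃ a (u * v), mul_assoc]
    rw [Con.coe_mul, ← mul_assoc]
    exact (congrArg (· * (v : (leftEqualizerCon S).Quotient)) hu).trans hv
  · rw [Equiv.symm_apply_eq]
    exact (h.transition_eq_mul ⟨_, rfl⟩ ⟨a, rfl⟩ b rfl).symm
end

section
/- Let ρ be a congruence on a semigroup S and let ρ* be the congruence defined by (a,b) ∈ ρ* iff (xa,xb) ∈ ρ for all x ∈ S. Then the factor semigroup S/ρ* is isomorphic to the right regular representation of S/ρ; that is, there is a semigroup isomorphism S/ρ* ≅ (S/ρ)/θ_{S/ρ} sending the ρ*-class of a to the θ_{S/ρ}-class of the ρ-class of a, where θ_{S/ρ} = {(u,v) : wu = wv for all w ∈ S/ρ}. -/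
theorem theta_coe_iff {S : Type*} [Semigroup S] (ρ : Con S) (a b : S) :
    theta ρ.Quotient (a : ρ.Quotient) (b : ρ.Quotient) ↔ conStar ρ a b :=
  ⟨fun h x => ρ.eq.mp (h (x : ρ.Quotient)),
    fun h x => Con.induction_on x fun x => ρ.eq.mpr (h x)⟩

/-- `S/ρ*` is isomorphic to the right regular representation `(S/ρ)/θ_{S/ρ}` of `S/ρ`,
via the map sending the `ρ*`-class of `a` to the `θ_{S/ρ}`-class of the `ρ`-class of `a`. -/
theorem quotient_conStar_mulEquiv_rightRegular {S : Type*} [Semigroup S] (ρ : Con S) :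
    ∃ e : (conStar ρ).Quotient ≃* (theta ρ.Quotient).Quotient,
      ∀ a : S, e (a : (conStar ρ).Quotient) =
        ((a : ρ.Quotient) : (theta ρ.Quotient).Quotient) := by
  let f : (conStar ρ).Quotient →ₙ* (theta ρ.Quotient).Quotient :=
    { toFun := fun q => Con.liftOn q
        (fun a => ((a : ρ.Quotient) : (theta ρ.Quotient).Quotient))
        fun a b h => (Con.eq _).mpr ((theta_coe_iff ρ a b).mpr h)
      map_mul' := fun p q => Con.induction_on₂ p q fun _ _ => rfl }
  have hf : Function.Bijective f := by
    constructor
    · intro p q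
      refine Con.induction_on₂ p q fun a b h => ?_
      exact (Con.eq _).mpr ((theta_coe_iff ρ a b).mp ((Con.eq _).mp h))
    · intro q
      refine Con.induction_on q fun u => Con.induction_on u fun a => ?_
      exact ⟨(a : (conStar ρ).Quotient), rfl⟩
  exact ⟨MulEquiv.ofBijective f hf, fun _ => rfl⟩
end

section
/- A congruence ρ on a semigroup S is a left equalizer simple congruence if and only if ρ* is a left cancellative congruence on S. -/
/-- A congruence `ρ` on a semigroup `S` is a left equalizer simple congruence iff `ρ*`
is a left cancellative congruence on `S`. -/
theorem leftEqualizerSimpleCon_iff_conStar_leftCancellative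
    {S : Type*} [Semigroup S] (ρ : Con S) :
    LeftEqualizerSimpleCon ρ ↔
      (∀ a b : S, (∃ x₀ : S, (conStar ρ) (x₀ * a) (x₀ * b)) → (conStar ρ) a b) := by
  constructor
  · rintro h a b ⟨x₀, hx₀⟩
    refine h a b ⟨x₀ * x₀, ?_⟩
    simpa only [mul_assoc] using hx₀ x₀
  · rintro h a b ⟨x₀, hx₀⟩
    exact h a b ⟨x₀, fun x => ρ.mul (ρ.refl x) hx₀⟩
end

section
/- If ρ is a left equalizer simple congruence on a semigroup S, then (ρ*)* = ρ*; that is, the sequence ρ^{(n)} defined by ρ^{(0)} = ρ and ρ^{(n+1)} = (ρ^{(n)})* satisfies ρ^{(1)} = ρ^{(2)} = ρ^{(3)} = ⋯. -/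
/-- If `ρ` is a left equalizer simple congruence on a semigroup `S`, then `(ρ*)* = ρ*`;
equivalently, the sequence `ρ⁽ⁿ⁾` (with `ρ⁽⁰⁾ = ρ`, `ρ⁽ⁿ⁺¹⁾ = (ρ⁽ⁿ⁾)*`) satisfies
`ρ⁽¹⁾ = ρ⁽²⁾ = ρ⁽³⁾ = ⋯`. -/
theorem conStar_conStar_eq_conStar {S : Type*} [Semigroup S] (ρ : Con S)
    (h : LeftEqualizerSimpleCon ρ) :
    conStar (conStar ρ) = conStar ρ ∧
      ∀ n : ℕ, 1 ≤ n → conStar^[n] ρ = conStar ρ := by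
  have star_star : conStar (conStar ρ) = conStar ρ := by
    ext a b
    constructor
    · intro hab x
      refine h a b ⟨x * x, ?_⟩ x
      rw [mul_assoc, mul_assoc]
      exact hab x x
    · intro hab x y
      rw [← mul_assoc, ← mul_assoc]
      exact hab (y * x)
  refine ⟨star_star, fun n hn => ?_⟩
  induction n, hn using Nat.le_induction with
  | base => rfl
  | succ n _ ih => rw [Function.iterate_succ_apply', ih, star_star]
end

section
/- Let F be an arbitrary field. If ρ is a left equalizer simple congruence on a semigroup S, then the right annihilator Ann_r(F[S/ρ*]) is trivial: the only element a of the semigroup algebra F[S/ρ*] with xa = 0 for all x ∈ F[S/ρ*] is a = 0. -/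
/-- If `ρ` is left equalizer simple, then `S/ρ*` is left cancellative. -/
theorem LeftEqualizerSimpleCon.isLeftCancelMul_quotient_conStar {S : Type*} [Semigroup S]
    {ρ : Con S} (h : LeftEqualizerSimpleCon ρ) : IsLeftCancelMul (conStar ρ).Quotient where
  mul_left_cancel := by
    intro s a b hab
    induction s using Con.induction_on with | _ s
    induction a using Con.induction_on with | _ a
    induction b using Con.induction_on with | _ b
    have hsab : ∀ x : S, ρ (x * (s * a)) (x * (s * b)) := (Con.eq (conStar ρ)).1 hab
    refine (Con.eq (conStar ρ)).2 (h a b ⟨s * s, ?_⟩)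
    simpa only [mul_assoc] using hsab s

/-- The right annihilator of the algebra of a left cancellative magma is trivial. -/
theorem MonoidAlgebra.eq_zero_of_forall_mul_eq_zero {R M : Type*} [Semiring R] [Mul M]
    [IsLeftCancelMul M] {a : MonoidAlgebra R M} (ha : ∀ x : MonoidAlgebra R M, x * a = 0) :
    a = 0 := by
  ext m
  have hm := a.coeff_single_mul_eq_mul_coeff (r := 1) (m := m) (m₁ := m * m) m
    fun _ _ => mul_right_inj m
  simpa [ha] using hm.symm

/-- If `ρ` is a left equalizer simple congruence on a semigroup `S`, then the right
annihilator of the semigroup algebra `F[S/ρ*]` is trivial, for any field `F`. -/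
theorem annihilator_quotient_conStar_trivial
    (F : Type*) [Field F] {S : Type*} [Semigroup S] (ρ : Con S)
    (h : LeftEqualizerSimpleCon ρ) :
    ∀ a : MonoidAlgebra F (conStar ρ).Quotient,
      (∀ x : MonoidAlgebra F (conStar ρ).Quotient, x * a = 0) → a = 0 := by
  have := h.isLeftCancelMul_quotient_conStar
  exact fun a ha => MonoidAlgebra.eq_zero_of_forall_mul_eq_zero ha
end
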